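/- Let k, m ≥ 2 and write S_k(m) = S_k(m−1) • S_{k−1}(N). Let a be a symbol of rank 1 in S_k(m), i.e., a local symbol belonging to one of the copies of S_k(m−1) and occupying the first position of its special block. If a is left-clamped in its copy of S_k(m−1), then a is left-clamped in S_k(m). -/

import Mathlib

/-! ### Sequences with special blocks, encoded as token lists

A sequence with special blocks is encoded as a list of tokens: `Tok.sym a` is an
occurrence of the symbol `a`, and `Tok.op` / `Tok.cl` are the opening and closing
parentheses delimiting the special blocks. -/

/-- Tokens of a symbol sequence with special blocks. -/
inductive Tok : Type where
  | sym : ℕ → Tok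
  | op : Tok
  | cl : Tok
deriving DecidableEq, Repr

/-- Tokens of an endpoint sequence with special blocks: `L a` / `R a` are the
left/right endpoint letters of the symbol `a`, and `op`/`cl` delimit blocks. -/
inductive ETok : Type where
  | L : ℕ → ETok
  | R : ℕ → ETok
  | op : ETok
  | cl : ETok
deriving DecidableEq, Repr

/-- Fresh relabeling of the symbols of the `i`-th local copy. -/
def loc (i a : ℕ) : ℕ := 2 * Nat.pair i a

/-- Relabeling of the global symbols. -/
def glob (a : ℕ) : ℕ := 2 * a + 1

/-- The underlying sequence of symbols of a token list (parentheses dropped). -/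
def symsOf : List Tok → List ℕ
  | [] => []
  | Tok.sym a :: r => a :: symsOf r
  | _ :: r => symsOf r

/-- Read a special block: the symbols up to (and excluding) the next closing
parenthesis, together with the remainder of the list after that parenthesis. -/
def takeBlock : List Tok → List ℕ × List Tok
  | [] => ([], [])
  | Tok.cl :: r => ([], r)
  | Tok.sym a :: r => ((takeBlock r).1.cons a, (takeBlock r).2)
  | Tok.op :: r => takeBlock r

theorem takeBlock_len : ∀ l : List Tok, (takeBlock l).2.length ≤ l.length := by
  intro l
  induction l with
  | nil => simp [takeBlock]
  | cons t r ih => cases t <;> simp [takeBlock] <;> omega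

/-- Auxiliary function for the shuffle `A • B`: traverse the `i`-th fresh copy of
`A` (relabeling its symbols by `loc i`), inserting the next global symbol of the
list `ins` (relabeled by `glob`) at the end of each special block and duplicating
the previously last symbol of that block immediately after the block.  The third
argument remembers the (relabeled) last symbol seen. -/
def copyIns (i : ℕ) : List Tok → List ℕ → Option ℕ → List Tok
  | [], _, _ => []
  | Tok.sym a :: r, ins, _ => Tok.sym (loc i a) :: copyIns i r ins (some (loc i a))
  | Tok.op :: r, ins, p => Tok.op :: copyIns i r ins p
  | Tok.cl :: r, b :: ins, some q =>
      Tok.sym (glob b) :: Tok.cl :: Tok.sym q :: copyIns i r ins (some q)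
  | Tok.cl :: r, ins, p => Tok.cl :: copyIns i r ins p

/-- The modified copy `Aᵢ'` of `A` used in the shuffle `A • B`: the symbols of the
`i`-th special block `blk` of `B` are inserted into the special blocks of the copy,
and another copy of the last symbol of `blk` is appended at the very end. -/
def copyA (i : ℕ) (A : List Tok) (blk : List ℕ) : List Tok :=
  copyIns i A blk none ++ (blk.getLast?.elim [] fun a => [Tok.sym (glob a)])

/-- Auxiliary function for the shuffle: traverse `B` (relabeling its symbols by
`glob`), replacing its `i`-th special block by the modified `i`-th copy of `A`. -/
def bulletAux (A : List Tok) : ℕ → List Tok → List Tok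
  | _, [] => []
  | i, Tok.op :: r => copyA i A (takeBlock r).1 ++ bulletAux A (i + 1) (takeBlock r).2
  | i, Tok.sym a :: r => Tok.sym (glob a) :: bulletAux A i r
  | i, Tok.cl :: r => Tok.cl :: bulletAux A i r
termination_by _ l => l.length
decreasing_by
  · exact Nat.lt_succ_of_le (takeBlock_len r)
  · exact Nat.lt_succ_self _
  · exact Nat.lt_succ_self _

/-- The shuffle `A • B` of two sequences with special blocks. -/
def bullet (A B : List Tok) : List Tok := bulletAux A 0 B

/-- Split each special block of length 2 into two special blocks of length 1. -/
def split2 : List Tok → List Tok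
  | Tok.op :: Tok.sym a :: Tok.sym b :: Tok.cl :: r =>
      Tok.op :: Tok.sym a :: Tok.cl :: Tok.op :: Tok.sym b :: Tok.cl :: split2 r
  | t :: r => t :: split2 r
  | [] => []

/-- The Hart–Sharir sequence `S₁(m) = (1 2 ⋯ m) (m−1) ⋯ 2 1 2 ⋯ m`,
with a single special block `(1 2 ⋯ m)`. -/
def S1 (m : ℕ) : List Tok :=
  Tok.op :: ((List.range' 1 m).map Tok.sym) ++ Tok.cl ::
    (((List.range' 1 (m - 1)).reverse.map Tok.sym) ++ ((List.range' 2 (m - 1)).map Tok.sym))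

/-- The number of special blocks of a token sequence. -/
def numBlocks (S : List Tok) : ℕ := S.count Tok.op

/-- The Hart–Sharir sequences `S_k(m)`, defined by double recursion:
`S₁(m)` is the `N`-shaped sequence above; for `k ≥ 2`, `S_k(1)` is `S_{k−1}(2)` with
each special block of length 2 split into two special blocks of length 1; and for
`k, m ≥ 2`, `S_k(m) = S_k(m−1) • S_{k−1}(N)` where `N` is the number of special
blocks of `S_k(m−1)`.  (The value for `k = 0` or `m = 0` is junk.) -/
def HS : ℕ → ℕ → List Tok
  | 0, _ => []
  | 1, m => S1 m
  | _ + 2, 0 => []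
  | k + 2, 1 => split2 (HS (k + 1) 2)
  | k + 2, m + 2 => bullet (HS (k + 2) (m + 1)) (HS (k + 1) (numBlocks (HS (k + 2) (m + 1))))
termination_by k m => (k, m)



/-- The list of special blocks of a token sequence (each block as its list of symbols). -/
def blocksOf : List Tok → List (List ℕ)
  | [] => []
  | Tok.op :: r => (takeBlock r).1 :: blocksOf (takeBlock r).2
  | _ :: r => blocksOf r
termination_by l => l.length
decreasing_by
  · exact Nat.lt_succ_of_le (takeBlock_len r)
  · exact Nat.lt_succ_self _

/-- The rank of a symbol: the position (counting from 1) that its first occurrence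
occupies within its special block (`0` if the symbol lies in no special block). -/
def rankOf (S : List Tok) (a : ℕ) : ℕ :=
  match (blocksOf S).find? (fun b => decide (a ∈ b)) with
  | some b => b.idxOf a + 1
  | none => 0

/-- Two symbols have their first occurrences in the same special block. -/
def SameBlock (S : List Tok) (a b : ℕ) : Prop :=
  ∃ blk ∈ blocksOf S, a ∈ blk ∧ b ∈ blk

/-- The symbol `a` is left-clamped in the sequence `s`: `s` contains the
subsequence `b a b a`, where `b` is the symbol immediately preceding the first
occurrence of `a` in `s`. -/
def LeftClamped (s : List ℕ) (a : ℕ) : Prop :=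
  ∃ (u v : List ℕ) (b : ℕ), s = u ++ b :: a :: v ∧ a ∉ u ∧ b ≠ a ∧
    [b, a, b, a].Sublist s

/-- The symbol `a` is right-clamped in the sequence `s`: `s` contains the
subsequence `a b a b`, where `b` is the symbol immediately following the last
occurrence of `a` in `s`. -/
def RightClamped (s : List ℕ) (a : ℕ) : Prop :=
  ∃ (u v : List ℕ) (b : ℕ), s = u ++ a :: b :: v ∧ a ∉ v ∧ b ≠ a ∧
    [a, b, a, b].Sublist s

/-- Auxiliary function for the endpoint sequence: the first argument collects the
symbols already seen.  The first occurrence of each symbol becomes an `L` letter,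
its last occurrence becomes an `R` letter, all other occurrences are deleted, and
parentheses are kept. -/
def EAux : List ℕ → List Tok → List ETok
  | _, [] => []
  | seen, Tok.op :: r => ETok.op :: EAux seen r
  | seen, Tok.cl :: r => ETok.cl :: EAux seen r
  | seen, Tok.sym a :: r =>
      if a ∈ seen then
        if a ∈ symsOf r then EAux seen r else ETok.R a :: EAux seen r
      else ETok.L a :: EAux (a :: seen) r

/-- The endpoint sequence `E(S)` of a sequence with special blocks. -/
def Efun (S : List Tok) : List ETok := EAux [] S

/-- Read a special block of an endpoint sequence: the labels of the `L` letters up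
to the next closing parenthesis, and the remainder of the list after it. -/
def takeBlockE : List ETok → List ℕ × List ETok
  | [] => ([], [])
  | ETok.cl :: r => ([], r)
  | ETok.L a :: r => ((takeBlockE r).1.cons a, (takeBlockE r).2)
  | _ :: r => takeBlockE r

theorem takeBlockE_len : ∀ l : List ETok, (takeBlockE l).2.length ≤ l.length := by
  intro l
  induction l with
  | nil => simp [takeBlockE]
  | cons t r ih => cases t <;> simp [takeBlockE] <;> omega

/-- Auxiliary function for the endpoint shuffle `A ∘ B`: traverse the `i`-th fresh
copy of `A` (relabeling by `loc i`), inserting the next left-endpoint letter of the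
list `ins` (relabeled by `glob`) at the end of each special block. -/
def ecopyIns (i : ℕ) : List ETok → List ℕ → List ETok
  | [], _ => []
  | ETok.L a :: r, ins => ETok.L (loc i a) :: ecopyIns i r ins
  | ETok.R a :: r, ins => ETok.R (loc i a) :: ecopyIns i r ins
  | ETok.op :: r, ins => ETok.op :: ecopyIns i r ins
  | ETok.cl :: r, b :: ins => ETok.L (glob b) :: ETok.cl :: ecopyIns i r ins
  | ETok.cl :: r, [] => ETok.cl :: ecopyIns i r []

/-- Auxiliary function for the endpoint shuffle: traverse `B` (relabeling by
`glob`), replacing its `i`-th special block by the `i`-th modified copy of `A`. -/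
def eshufAux (A : List ETok) : ℕ → List ETok → List ETok
  | _, [] => []
  | i, ETok.op :: r => ecopyIns i A (takeBlockE r).1 ++ eshufAux A (i + 1) (takeBlockE r).2
  | i, ETok.L a :: r => ETok.L (glob a) :: eshufAux A i r
  | i, ETok.R a :: r => ETok.R (glob a) :: eshufAux A i r
  | i, ETok.cl :: r => ETok.cl :: eshufAux A i r
termination_by _ l => l.length
decreasing_by
  · exact Nat.lt_succ_of_le (takeBlockE_len r)
  · exact Nat.lt_succ_self _
  · exact Nat.lt_succ_self _
  · exact Nat.lt_succ_self _

/-- The endpoint shuffle `A ∘ B` of two endpoint sequences with special blocks. -/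
def eshuffle (A B : List ETok) : List ETok := eshufAux A 0 B

/-- The token list is a well-formed sequence with special blocks: a concatenation
of symbols and of parenthesized blocks consisting only of symbols. -/
inductive Blocked : List Tok → Prop
  | nil : Blocked []
  | sym (a : ℕ) {l : List Tok} : Blocked l → Blocked (Tok.sym a :: l)
  | blk (b : List ℕ) {l : List Tok} :
      Blocked l → Blocked (Tok.op :: b.map Tok.sym ++ Tok.cl :: l)

/-- The special blocks of `S` contain only first occurrences of symbols, and every
symbol of `S` makes its first occurrence inside a special block. -/
def FirstOccBlocks (S : List Tok) : Prop :=
  (∀ (u b v : List Tok), S = u ++ Tok.op :: b ++ Tok.cl :: v →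
      ∀ a : ℕ, Tok.sym a ∈ b → a ∉ symsOf u ∧ (symsOf b).count a = 1) ∧
  (∀ a ∈ symsOf S, ∃ (u b v : List Tok),
      S = u ++ Tok.op :: b ++ Tok.cl :: v ∧ Tok.sym a ∈ b ∧ a ∉ symsOf u)

theorem loc_inj {i j a b : ℕ} : loc i a = loc j b ↔ i = j ∧ a = b := by
  simp [loc, Nat.pair_eq_pair]

theorem loc_ne_glob (i a b : ℕ) : loc i a ≠ glob b := by
  unfold loc glob
  omega

theorem symsOf_append (s t : List Tok) : symsOf (s ++ t) = symsOf s ++ symsOf t := by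
  induction s with
  | nil => rfl
  | cons x s ih => cases x <;> simp [symsOf, ih]

/-- Every symbol of a modified copy is the remembered symbol, a local one, or a global one. -/
theorem mem_symsOf_copyIns {i x : ℕ} {A : List Tok} {ins : List ℕ} {p : Option ℕ}
    (h : x ∈ symsOf (copyIns i A ins p)) :
    p = some x ∨ (∃ c, x = loc i c) ∨ ∃ c, x = glob c := by
  induction A generalizing ins p with
  | nil => simp [copyIns, symsOf] at h
  | cons t r ih =>
    rcases t with c | _ | _
    · simp only [copyIns, symsOf, List.mem_cons] at h
      rcases h with rfl | h
      · exact .inr (.inl ⟨c, rfl⟩)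
      · rcases ih h with h | h
        · exact .inr (.inl ⟨c, (Option.some.inj h).symm⟩)
        · exact .inr h
    · exact ih (by simpa [copyIns, symsOf] using h)
    · rcases ins with _ | ⟨g, ins⟩
      · exact ih (by simpa [copyIns, symsOf] using h)
      · rcases p with _ | q
        · exact ih (by simpa [copyIns, symsOf] using h)
        · simp only [copyIns, symsOf, List.mem_cons] at h
          rcases h with rfl | rfl | h
          · exact .inr (.inr ⟨g, rfl⟩)
          · exact .inl rfl
          · exact ih h

/-- A modified copy contains the relabeled original sequence as a subsequence. -/
theorem map_loc_sublist_symsOf_copyIns (i : ℕ) (A : List Tok) (ins : List ℕ) (p : Option ℕ) :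
    ((symsOf A).map (loc i)).Sublist (symsOf (copyIns i A ins p)) := by
  induction A generalizing ins p with
  | nil => simp [copyIns, symsOf]
  | cons t r ih =>
    rcases t with c | _ | _
    · simpa [copyIns, symsOf] using ih ins _
    · simpa [copyIns, symsOf] using ih ins p
    · rcases ins with _ | ⟨g, ins⟩
      · simpa [copyIns, symsOf] using ih [] p
      · rcases p with _ | q
        · simpa [copyIns, symsOf] using ih (g :: ins) none
        · simpa [copyIns, symsOf] using ((ih ins (some q)).cons q).cons (glob g)

/-- In a modified copy, the next local symbol is immediately preceded by an occurrence of
the remembered symbol. -/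
theorem symsOf_copyIns_some {i q a : ℕ} {A : List Tok} {v : List ℕ}
    (hA : symsOf A = a :: v) (hq : q ≠ loc i a) (ins : List ℕ) :
    ∃ w z, q :: symsOf (copyIns i A ins (some q)) = w ++ q :: loc i a :: z ∧ loc i a ∉ w := by
  induction A generalizing ins with
  | nil => simp [symsOf] at hA
  | cons t r ih =>
    rcases t with c | _ | _
    · simp only [symsOf, List.cons.injEq] at hA
      exact ⟨[], symsOf (copyIns i r ins (some (loc i a))), by simp [copyIns, symsOf, hA.1],
        by simp⟩
    · exact ih hA ins
    · rcases ins with _ | ⟨g, ins⟩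
      · exact ih hA []
      · obtain ⟨w, z, h, hw⟩ := ih hA ins
        exact ⟨q :: glob g :: w, z, by simp [copyIns, symsOf, h],
          by simp [hq.symm, loc_ne_glob, hw]⟩

/-- The predecessor of the first occurrence of a symbol is preserved in a modified copy. -/
theorem symsOf_copyIns_pred {i a b : ℕ} {A : List Tok} {u v : List ℕ} {p : Option ℕ}
    (hA : symsOf A = u ++ b :: a :: v) (hu : a ∉ u) (hb : b ≠ a) (hp : p ≠ some (loc i a))
    (ins : List ℕ) :
    ∃ w z, symsOf (copyIns i A ins p) = w ++ loc i b :: loc i a :: z ∧ loc i a ∉ w := by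
  induction A generalizing u ins p with
  | nil => simp [symsOf] at hA
  | cons t r ih =>
    rcases t with c | _ | _
    · rcases u with _ | ⟨d, u⟩
      · simp only [symsOf, List.nil_append, List.cons.injEq] at hA
        obtain ⟨rfl, hA⟩ := hA
        exact symsOf_copyIns_some hA (by simp [loc_inj, hb]) ins
      · simp only [symsOf, List.cons_append, List.cons.injEq] at hA
        obtain ⟨rfl, hA⟩ := hA
        simp only [List.mem_cons, not_or] at hu
        have hc : loc i a ≠ loc i c := by simp [loc_inj, hu.1]
        obtain ⟨w, z, h, hw⟩ := ih hA hu.2 (p := some (loc i c)) (by simp [hc.symm]) ins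
        exact ⟨loc i c :: w, z, by simp [copyIns, symsOf, h], by simp [hc, hw]⟩
    · exact ih hA hu hp ins
    · rcases ins with _ | ⟨g, ins⟩
      · simpa [copyIns, symsOf] using ih hA hu hp []
      · rcases p with _ | q
        · simpa [copyIns, symsOf] using ih hA hu hp (g :: ins)
        · obtain ⟨w, z, h, hw⟩ := ih hA hu hp ins
          have hq : loc i a ≠ q := fun e => hp (by rw [e])
          exact ⟨glob g :: q :: w, z, by simp [copyIns, symsOf, h],
            by simp [hq, loc_ne_glob, hw]⟩

/-- If a symbol of the `i`-th local copy occurs in the shuffle, then so does the whole `i`-th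
modified copy, and the symbol does not occur before it. -/
theorem exists_symsOf_bulletAux_eq {A : List Tok} {i a : ℕ} (j : ℕ) (B : List Tok)
    (h : loc i a ∈ symsOf (bulletAux A j B)) :
    ∃ w blk z, symsOf (bulletAux A j B) = w ++ symsOf (copyIns i A blk none) ++ z ∧
      loc i a ∉ w := by
  induction j, B using bulletAux.induct with
  | case1 j => simp [bulletAux, symsOf] at h
  | case2 j r ih =>
    rw [bulletAux, symsOf_append] at h ⊢
    by_cases hij : j = i
    · subst hij
      refine ⟨[], (takeBlock r).1, ?_⟩
      simp [copyA, symsOf_append]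
    · have hnot : loc i a ∉ symsOf (copyA j A (takeBlock r).1) := by
        rw [copyA, symsOf_append, List.mem_append, not_or]
        refine ⟨fun hm => ?_, ?_⟩
        · rcases mem_symsOf_copyIns hm with hm | ⟨c, hm⟩ | ⟨c, hm⟩
          · cases hm
          · exact hij (loc_inj.1 hm).1.symm
          · exact loc_ne_glob _ _ _ hm
        · cases (takeBlock r).1.getLast? <;> simp [symsOf, loc_ne_glob]
      obtain ⟨w, blk, z, he, hw⟩ := ih ((List.mem_append.1 h).resolve_left hnot)
      exact ⟨symsOf (copyA j A (takeBlock r).1) ++ w, blk, z, by simp [he],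
        by simp [hnot, hw]⟩
  | case3 j c r ih =>
    simp only [bulletAux, symsOf, List.mem_cons, loc_ne_glob, false_or] at h ⊢
    obtain ⟨w, blk, z, he, hw⟩ := ih h
    exact ⟨glob c :: w, blk, z, by simp [he], by simp [loc_ne_glob, hw]⟩
  | case4 j r ih =>
    simp only [bulletAux, symsOf] at h ⊢
    exact ih h

/-- Local symbols that are left-clamped in `A` stay left-clamped in the shuffle `A • B`. -/
theorem LeftClamped.bullet {A B : List Tok} {i a : ℕ} (hA : LeftClamped (symsOf A) a)
    (hmem : loc i a ∈ symsOf (bullet A B)) : LeftClamped (symsOf (bullet A B)) (loc i a) := by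
  obtain ⟨u, v, b, hs, hu, hb, hsub⟩ := hA
  obtain ⟨w, blk, z, he, hw⟩ := exists_symsOf_bulletAux_eq 0 B hmem
  obtain ⟨w', z', he', hw'⟩ := symsOf_copyIns_pred (i := i) (p := none) hs hu hb (by simp) blk
  refine ⟨w ++ w', z' ++ z, loc i b, ?_, by simp [hw, hw'], by simp [loc_inj, hb], ?_⟩
  · simp [_root_.bullet, he, he']
  · rw [_root_.bullet, he]
    have h := (hsub.map (loc i)).trans (map_loc_sublist_symsOf_copyIns i A blk none)
    exact (h.trans (List.sublist_append_right w _)).trans (List.sublist_append_left _ z)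

/-- Lemma `lem_rank1_leftclamped`: let `k, m ≥ 2` and write
`S_k(m) = S_k(m−1) • S_{k−1}(N)`.  Let `a = loc i a₀` be a rank-1 symbol of
`S_k(m)`, i.e. a local symbol belonging to the `i`-th copy of `S_k(m−1)` (where it
is the symbol `a₀`) and occupying the first position of its special block.  If
`a₀` is left-clamped in `S_k(m−1)`, then `a` is left-clamped in `S_k(m)`. -/
theorem lem_rank1_leftclamped (k m : ℕ) (hk : 2 ≤ k) (hm : 2 ≤ m) (i a0 : ℕ)
    (hmem : loc i a0 ∈ symsOf (HS k m))
    (hrank : rankOf (HS k m) (loc i a0) = 1)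
    (hclamp : LeftClamped (symsOf (HS k (m - 1))) a0) :
    LeftClamped (symsOf (HS k m)) (loc i a0) := by
  obtain ⟨k, rfl⟩ := Nat.exists_eq_add_of_le' hk
  obtain ⟨m, rfl⟩ := Nat.exists_eq_add_of_le' hm
  rw [HS] at hmem ⊢
  exact LeftClamped.bullet hclamp hmem
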